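/- Let X be a connected, separable subset of a topological space; let ≿ be a complete transitive continuous order on X and ≽ a complete transitive relation on X × X with closed graph (A3), jointly satisfying A1 and A1'. If x, z ∈ X with x ≻ z, then there exists y* ∈ X, unique up to indifference, such that (x, y*) ∼ (y*, z) and x ≻ y* ≻ z (y* is a 'utility midpoint' of x and z). -/

import Mathlib

theorem stmt14 {X : Type*} [TopologicalSpace X] [ConnectedSpace X]
    [TopologicalSpace.SeparableSpace X]
    (R : X → X → Prop) (S : X → X → X → X → Prop)
    (hRcomp : ∀ a b : X, R a b ∨ R b a)
    (hRtrans : ∀ a b c : X, R a b → R b c → R a c)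
    (hRcont : ∀ y : X, IsOpen {x : X | R x y ∧ ¬ R y x} ∧ IsOpen {x : X | R y x ∧ ¬ R x y})
    (hScomp : ∀ a b c d : X, S a b c d ∨ S c d a b)
    (hStrans : ∀ a b c d e f : X, S a b c d → S c d e f → S a b e f)
    (hA3 : IsClosed {p : X × X × X × X | S p.1 p.2.1 p.2.2.1 p.2.2.2})
    (hA1 : ∀ a b c : X, S a c b c ↔ R a b)
    (hA1' : ∀ a b c : X, S c a c b ↔ R b a)
    (x z : X) (hxz : R x z ∧ ¬ R z x) :
    ∃ ys : X, (S x ys ys z ∧ S ys z x ys) ∧ (R x ys ∧ ¬ R ys x) ∧ (R ys z ∧ ¬ R z ys) ∧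
      ∀ y2 : X, (S x y2 y2 z ∧ S y2 z x y2) → (R ys y2 ∧ R y2 ys) := by
  have hA : IsClosed {y : X | S x y y z} :=
    hA3.preimage (f := fun y : X => (x, y, y, z)) (by fun_prop)
  have hB : IsClosed {y : X | S y z x y} :=
    hA3.preimage (f := fun y : X => (y, z, x, y)) (by fun_prop)
  obtain ⟨y, -, hy₁, hy₂⟩ := isPreconnected_closed_iff.1 (isPreconnected_univ (α := X)) _ _ hA hB
    (fun y _ => hScomp x y y z)
    ⟨z, trivial, (hA1 x z z).2 hxz.1⟩ ⟨x, trivial, (hA1' z x x).2 hxz.1⟩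
  replace hy₁ : S x y y z := hy₁
  replace hy₂ : S y z x y := hy₂
  -- The left side of the midpoint equation is antitone in the midpoint, the right side monotone.
  have key : ∀ a b : X, S x a a z → S b z x b → R a b → R b a := fun a b ha hb hab =>
    (hA1' a b x).1
      (hStrans _ _ _ _ _ _ ha (hStrans _ _ _ _ _ _ ((hA1 a b z).2 hab) hb))
  have hxy : ¬ R y x := fun h => hxz.2 <| (hA1' x z x).1 <|
    hStrans _ _ _ _ _ _ ((hA1' x y x).2 h) (hStrans _ _ _ _ _ _ hy₁ ((hA1 y x z).2 h))
  have hyz : ¬ R z y := fun h => hxz.2 <| (hA1 z x z).1 <|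
    hStrans _ _ _ _ _ _ ((hA1 z y z).2 h) (hStrans _ _ _ _ _ _ hy₂ ((hA1' y z x).2 h))
  refine ⟨y, ⟨hy₁, hy₂⟩, ⟨(hRcomp x y).resolve_right hxy, hxy⟩,
    ⟨(hRcomp y z).resolve_right hyz, hyz⟩, fun w hw => ?_⟩
  rcases hRcomp y w with h | h
  · exact ⟨h, key y w hy₁ hw.2 h⟩
  · exact ⟨key w y hw.1 hy₂ h, h⟩
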